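/- For every fixed directed graph H on h vertices and every ε > 0 there exists δ > 0 such that the following holds for every directed graph G on n vertices: if G contains at most δ·n^h copies of H (i.e., at most δ·n^h subgraphs isomorphic to H, where a copy of H is given by an injective map from the vertices of H to the vertices of G sending every arc of H to an arc of G), then there exists a set E of at most ε·n² arcs of G such that the directed graph obtained from G by removing the arcs of E contains no copy of H. -/

import Mathlib

open Finset

open Classical in
/-- A relation between two finite sets is `(m, d)`-lower regular if any two subsets with at least
`m` elements span at least a proportion `d` of all possible pairs. -/
def IsLowerRegular {α β : Type*} (r : α → β → Prop) (m d : ℝ) (S : Finset α) (T : Finset β) :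
    Prop :=
  ∀ S' ⊆ S, ∀ T' ⊆ T, m ≤ #S' → m ≤ #T' →
    d * (#S' * #T') ≤ #(Rel.interedges r S' T')

theorem IsLowerRegular.mono {α β : Type*} {r : α → β → Prop} {m d : ℝ} {S S' : Finset α}
    {T T' : Finset β} (h : IsLowerRegular r m d S T) (hS : S' ⊆ S) (hT : T' ⊆ T) :
    IsLowerRegular r m d S' T' :=
  fun _ hA _ hB => h _ (hA.trans hS) _ (hB.trans hT)

open Classical in
theorem IsLowerRegular.card_low_degree_le {α β : Type*} {r : α → β → Prop} {m d : ℝ}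
    {S : Finset α} {T : Finset β} (h : IsLowerRegular r m d S T) (hm : 0 ≤ m) (hT : m ≤ #T) :
    (#{x ∈ S | (#{y ∈ T | r x y} : ℝ) < d * #T} : ℝ) ≤ m := by
  set B := {x ∈ S | (#{y ∈ T | r x y} : ℝ) < d * #T} with hB
  by_contra! hlt
  have hne : B.Nonempty := by
    rw [← Finset.card_pos]
    exact_mod_cast hm.trans_lt hlt
  have h1 := h B (filter_subset _ _) T Subset.rfl hlt.le hT
  have h2 : #(Rel.interedges r B T) = ∑ x ∈ B, #{y ∈ T | r x y} := by
    simp only [Rel.interedges, card_filter, sum_product]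
  rw [h2] at h1
  push_cast at h1
  have h3 : ∑ x ∈ B, (#{y ∈ T | r x y} : ℝ) < ∑ x ∈ B, d * #T :=
    sum_lt_sum_of_nonempty hne fun x hx => (mem_filter.1 hx).2
  rw [sum_const, nsmul_eq_mul] at h3
  linarith

open Classical in
/-- Counting lemma for families of pairwise lower regular sets. -/
theorem pow_le_card_transversals {β : Type*} [Fintype β] {m d : ℝ} (hm : 0 ≤ m) (hd : 0 < d)
    (hd1 : d ≤ 1) (k : ℕ) (Y : Fin k → Finset β) (R : Fin k → Fin k → β → β → Prop)
    (hY : ∀ i, k * m ≤ d ^ k * #(Y i))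
    (hR : ∀ i j, i < j → IsLowerRegular (R i j) m d (Y i) (Y j)) :
    m ^ k ≤ #{φ : Fin k → β | (∀ i, φ i ∈ Y i) ∧ ∀ i j, i < j → R i j (φ i) (φ j)} := by
  induction k with
  | zero => simp
  | succ k ih =>
    have hdk : d ^ (k + 1) ≤ 1 := pow_le_one₀ hd.le hd1
    have hY' : ∀ i, (k + 1) * m ≤ #(Y i) := fun i => by
      have := hY i
      push_cast at this
      nlinarith [(#(Y i)).cast_nonneg (α := ℝ)]
    have hkm : 0 ≤ k * m := by positivity
    let N : β → Fin k → Finset β := fun x j => {y ∈ Y j.succ | R 0 j.succ x y}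
    let good : Finset β := {x ∈ Y 0 | ∀ j : Fin k, d * #(Y j.succ) ≤ #(N x j)}
    have hgood : m ≤ #good := by
      have hsub : Y 0 ⊆ good ∪ univ.biUnion
          fun j : Fin k => {x ∈ Y 0 | (#(N x j) : ℝ) < d * #(Y j.succ)} := by
        intro x hx
        by_cases hg : x ∈ good
        · exact mem_union_left _ hg
        · simp only [good, mem_filter, hx, true_and, not_forall, not_le] at hg
          obtain ⟨j, hj⟩ := hg
          exact mem_union_right _ (mem_biUnion.2 ⟨j, mem_univ _, mem_filter.2 ⟨hx, hj⟩⟩)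
      have h1 : (#(Y 0) : ℝ) ≤ #good + ∑ j : Fin k,
          (#{x ∈ Y 0 | (#(N x j) : ℝ) < d * #(Y j.succ)} : ℝ) := by
        exact_mod_cast (card_le_card hsub).trans ((card_union_le _ _).trans
          (Nat.add_le_add_left card_biUnion_le _))
      have h2 : ∑ j : Fin k, (#{x ∈ Y 0 | (#(N x j) : ℝ) < d * #(Y j.succ)} : ℝ) ≤
          ∑ _j : Fin k, m :=
        sum_le_sum fun j _ => (hR 0 j.succ j.succ_pos).card_low_degree_le hm
          (by linarith [hY' j.succ])
      simp only [sum_const, card_univ, Fintype.card_fin, nsmul_eq_mul] at h2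
      linarith [hY' 0]
    let F : β → Finset (Fin k → β) := fun x =>
      {φ | (∀ i, φ i ∈ N x i) ∧ ∀ i j, i < j → R i.succ j.succ (φ i) (φ j)}
    have hF : ∀ x ∈ good, m ^ k ≤ #(F x) := fun x hx => by
      refine ih (N x) (fun i j => R i.succ j.succ) (fun i => ?_) fun i j hij =>
        (hR _ _ (Fin.succ_lt_succ_iff.2 hij)).mono (filter_subset _ _) (filter_subset _ _)
      have h1 := (mem_filter.1 hx).2 i
      have h2 := hY i.succ
      push_cast at h2
      have h3 : d ^ k * (d * #(Y i.succ)) ≤ d ^ k * #(N x i) := by gcongr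
      rw [← mul_assoc, ← pow_succ] at h3
      linarith
    calc m ^ (k + 1) = m * m ^ k := pow_succ' _ _
      _ ≤ #good * m ^ k := by gcongr
      _ = ∑ x ∈ good, m ^ k := by simp
      _ ≤ ∑ x ∈ good, (#(F x) : ℝ) := sum_le_sum hF
      _ = #(good.sigma F) := by simp
      _ ≤ _ := by
        refine Nat.cast_le.2 (card_le_card_of_injOn (fun p => Fin.cons p.1 p.2) ?_ ?_)
        · rintro ⟨x, φ⟩ hp
          simp only [coe_sigma, Set.mem_sigma_iff, mem_coe, F, N, good, mem_filter, mem_univ,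
            true_and] at hp
          simp only [coe_filter, mem_univ, true_and, Set.mem_ofPred_eq, Fin.forall_fin_succ,
            Fin.cons_zero, Fin.cons_succ, Fin.succ_lt_succ_iff]
          refine ⟨⟨hp.1.1, fun i => (hp.2.1 i).1⟩, ⟨by simp, fun j _ => (hp.2.1 j).2⟩,
            fun i => ⟨by simp, hp.2.2 i⟩⟩
        · rintro ⟨x, φ⟩ _ ⟨y, ψ⟩ _ h
          obtain ⟨rfl, rfl⟩ := Fin.cons_inj.1 h
          rfl

open Classical in
theorem SimpleGraph.IsUniform.isLowerRegular {α : Type*} {K : SimpleGraph α} {ε d m : ℝ}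
    {A B X Y : Finset α} (h : K.IsUniform ε A B) (hX : X ⊆ A) (hY : Y ⊆ B)
    (hAm : #A * ε ≤ m) (hBm : #B * ε ≤ m) (hAX : #A * ε ≤ #X) (hBY : #B * ε ≤ #Y)
    (hX0 : X.Nonempty) (hY0 : Y.Nonempty)
    (hd : (d + 2 * ε) * (#X * #Y) ≤ #(K.interedges X Y)) :
    IsLowerRegular K.Adj m d X Y := by
  have key : ∀ S T : Finset α, S.Nonempty → T.Nonempty →
      (#(K.interedges S T) : ℝ) = K.edgeDensity S T * (#S * #T) := by
    intro S T hS hT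
    have := hS.card_pos
    have := hT.card_pos
    rw [K.edgeDensity_def]
    push_cast
    field_simp
  intro S hS T hT hmS hmT
  obtain rfl | hS0 := S.eq_empty_or_nonempty
  · simp
  obtain rfl | hT0 := T.eq_empty_or_nonempty
  · simp
  change d * (#S * #T) ≤ (#(K.interedges S T) : ℝ)
  rw [key S T hS0 hT0]
  have h1 := abs_lt.1 (h hX hY hAX hBY)
  have h2 := abs_lt.1 (h (hS.trans hX) (hT.trans hY) (hAm.trans hmS) (hBm.trans hmT))
  rw [key X Y hX0 hY0] at hd
  have hXY : (0 : ℝ) < #X * #Y := by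
    have := hX0.card_pos
    have := hY0.card_pos
    positivity
  have h3 := le_of_mul_le_mul_right hd hXY
  gcongr
  linarith

open Classical in
/-- A partition of the vertices into the fibres of `g` produces few edges between pairs of classes
of low density; here `F a` is the fibre containing `a`. -/
theorem card_edges_sparse_fibers_le {α γ : Type*} [Fintype α] [Fintype γ] {g : α → γ}
    {F : α → Finset α} (hF : ∀ a x, x ∈ F a ↔ g x = g a) (r : α → α → Prop) {d : ℝ} (hd : 0 ≤ d) :
    (#{p : α × α | r p.1 p.2 ∧
        (#(Rel.interedges r (F p.1) (F p.2)) : ℝ) < d * (#(F p.1) * #(F p.2))} : ℝ) ≤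
      d * Fintype.card α ^ 2 := by
  obtain rfl : F = fun a => ({x | g x = g a} : Finset α) := by
    ext a x
    simp [hF]
  rw [card_eq_sum_card_fiberwise (f := Prod.map g g) (t := univ) (by simp)]
  have hsum : (Fintype.card α : ℝ) = ∑ c, (#{x | g x = c} : ℝ) := by
    rw [← card_univ, card_eq_sum_card_fiberwise (f := g) (t := univ) (by simp)]
    push_cast
    rfl
  rw [hsum, sq, sum_mul_sum, ← Fintype.sum_prod_type', mul_sum]
  push_cast
  refine sum_le_sum fun c _ => ?_
  by_cases hc : (#(Rel.interedges r {x | g x = c.1} {x | g x = c.2}) : ℝ) <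
      d * (#{x | g x = c.1} * #{x | g x = c.2})
  · refine le_trans (Nat.cast_le.2 (card_le_card fun p hp => ?_)) hc.le
    simp only [mem_filter, mem_univ, true_and] at hp
    obtain ⟨⟨hr, -⟩, rfl⟩ := hp
    simpa [Rel.mem_interedges_iff] using hr
  · rw [filter_filter, filter_false_of_mem]
    · simp only [card_empty, Nat.cast_zero]
      positivity
    · rintro p - ⟨⟨-, hp⟩, rfl⟩
      exact hc hp

open Classical in
theorem Finpartition.card_small_fibers_le {α ι : Type*} [Fintype α] [Fintype ι]
    (P : Finpartition (univ : Finset α)) (f : α → ι) {η : ℝ} (hη : 0 ≤ η) :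
    (#{a : α | (#{b ∈ P.part a | f b = f a} : ℝ) < η * #(P.part a)} : ℝ) ≤
      Fintype.card ι * η * Fintype.card α := by
  rw [card_eq_sum_card_fiberwise (f := fun a => (P.part a, f a)) (t := P.parts ×ˢ univ)
    (fun a _ => by simp)]
  have hsum : (Fintype.card ι * η * Fintype.card α : ℝ) =
      ∑ c ∈ P.parts ×ˢ (univ : Finset ι), η * #c.1 := by
    rw [sum_product, ← card_univ (α := α), ← P.sum_card_parts]
    simp [mul_sum, mul_assoc]
  rw [hsum]
  push_cast
  refine sum_le_sum fun c hc => ?_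
  obtain ⟨A, i⟩ := c
  have hA : A ∈ P.parts := (mem_product.1 hc).1
  by_cases hs : (#{b ∈ A | f b = i} : ℝ) < η * #A
  · refine le_trans (Nat.cast_le.2 (card_le_card fun p hp => ?_)) hs.le
    simp only [mem_filter, mem_univ, true_and, Prod.mk.injEq] at hp ⊢
    exact ⟨(P.part_eq_iff_mem hA).1 hp.2.1, hp.2.2⟩
  · rw [filter_filter, filter_false_of_mem]
    · simp only [card_empty, Nat.cast_zero]
      positivity
    · rintro p - ⟨hp, h⟩
      simp only [Prod.mk.injEq] at h
      obtain ⟨rfl, rfl⟩ := h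
      exact hs hp

open Classical in
theorem exists_union_rectangles {α : Type*} [Fintype α] (A B C : Finset (α × α)) (S : Finset α) :
    ∃ U : Finset (α × α), #U ≤ #A + #B + #C + 2 * (#S * Fintype.card α) ∧
      ∀ a b, (a, b) ∉ U → (a, b) ∉ A ∧ (a, b) ∉ B ∧ (a, b) ∉ C ∧ a ∉ S ∧ b ∉ S := by
  refine ⟨A ∪ B ∪ C ∪ S ×ˢ univ ∪ univ ×ˢ S, ?_, fun a b h => ?_⟩
  · have h1 := card_union_le (A ∪ B ∪ C ∪ S ×ˢ univ) (univ ×ˢ S)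
    have h2 := card_union_le (A ∪ B ∪ C) (S ×ˢ univ)
    have h3 := card_union_le (A ∪ B) C
    have h4 := card_union_le A B
    rw [card_product, card_univ] at h1 h2
    lia
  · simpa [and_assoc] using h

set_option maxHeartbeats 1000000 in
open Classical in
/-- Regularity lemma with cleaning for graphs labelled by `ι`: outside a sparse set of pairs, every
edge lies in a lower regular pair of large sets, on each of which the label is constant. -/
theorem exists_lowerRegular_cleaning (ι : Type*) [Fintype ι] [Nonempty ι] {ε : ℝ} (hε : 0 < ε) :
    ∃ d κ : ℝ, 0 < d ∧ d ≤ 1 / 2 ∧ 0 < κ ∧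
      ∀ (α : Type*) [Fintype α] (f : α → ι) (K : SimpleGraph α) (n : ℕ),
        Fintype.card α = Fintype.card ι * n → 1 ≤ κ * n →
        ∃ (m : ℝ) (B : Finset (α × α)) (X : α → Finset α),
          κ * n ≤ m ∧
          Fintype.card ι * m ≤ d ^ Fintype.card ι * n ∧
          #B ≤ ε * (n : ℝ) ^ 2 ∧
          (∀ a, ∀ b ∈ X a, f b = f a) ∧
          ∀ a b, K.Adj a b → (a, b) ∉ B →
            Fintype.card ι * m ≤ d ^ Fintype.card ι * #(X a) ∧
            Fintype.card ι * m ≤ d ^ Fintype.card ι * #(X b) ∧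
            IsLowerRegular K.Adj m d (X a) (X b) := by
  set h : ℕ := Fintype.card ι with hh
  have hpos : 0 < h := Fintype.card_pos
  have h1 : (1 : ℝ) ≤ h := by exact_mod_cast hpos
  set e : ℝ := min ε 1 / h ^ 2 with he
  have he0 : 0 < e := by positivity
  have heε : e * h ^ 2 ≤ ε := by
    rw [he, div_mul_cancel₀ _ (by positivity)]
    exact min_le_left _ _
  have he1 : e ≤ 1 := by
    rw [he, div_le_one (by positivity)]
    exact (min_le_right _ _).trans (one_le_pow₀ h1)
  set d : ℝ := e / 8 with hd
  have hd0 : 0 < d := by positivity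
  set η : ℝ := e / (16 * h) with hη
  have hη0 : 0 < η := by positivity
  have hhη : h * η = e / 16 := by rw [hη]; field_simp
  have hηe : η ≤ e / 16 := by nlinarith
  have hdp : 0 < d ^ h := by positivity
  have hdp1 : d ^ h ≤ 1 := pow_le_one₀ hd0.le (by linarith)
  set ε₀ : ℝ := d ^ h * η / (4 * h) with hε₀
  have hε₀0 : 0 < ε₀ := by positivity
  have hhε₀ : 4 * (h * ε₀) = d ^ h * η := by rw [hε₀]; field_simp
  have hε₀η : 4 * ε₀ ≤ η := by nlinarith
  set l : ℕ := ⌈8 / e⌉₊ with hl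
  set M : ℕ := SzemerediRegularity.bound ε₀ l with hM
  have hM0 : 0 < M := SzemerediRegularity.bound_pos _ _
  refine ⟨d, ε₀ / M, hd0, by linarith, by positivity, fun α _ f K n hN hV => ?_⟩
  have hMn : (M : ℝ) ≤ n := by
    rw [div_mul_eq_mul_div, one_le_div (by positivity)] at hV
    nlinarith [(Nat.cast_nonneg n : (0 : ℝ) ≤ n)]
  have hn0 : (0 : ℝ) < n := lt_of_lt_of_le (by exact_mod_cast hM0) hMn
  have hlN : l ≤ Fintype.card α := by
    rw [hN]
    exact ((SzemerediRegularity.le_bound ε₀ l).trans (by exact_mod_cast hMn)).trans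
      (Nat.le_mul_of_pos_left _ hpos)
  obtain ⟨P, hP, hlP, hPM, hPK⟩ := szemeredi_regularity K hε₀0 hlN
  have hA0 : (univ : Finset α).Nonempty := by
    rw [← card_pos, card_univ, hN]
    exact Nat.mul_pos hpos (by exact_mod_cast hn0)
  have hp0 : 0 < #P.parts := (P.parts_nonempty hA0.ne_empty).card_pos
  set q : ℕ := #(univ : Finset α) / #P.parts with hq
  have hq1 : 1 ≤ q := (Nat.one_le_div_iff hp0).2 P.card_parts_le_card
  have hq1' : (1 : ℝ) ≤ q := by exact_mod_cast hq1
  have hqhn : (q : ℝ) ≤ h * n := by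
    rw [← Nat.cast_mul, ← hN, ← card_univ]
    exact_mod_cast Nat.div_le_self _ _
  have hqn : h * n ≤ (M : ℝ) * (q + 1) := by
    have h2 : h * n < (q + 1) * #P.parts := by
      rw [← hN, ← card_univ, hq]
      exact Nat.lt_mul_of_div_lt (Nat.lt_succ_self _) hp0
    have h3 : (h * n : ℝ) ≤ (q + 1) * #P.parts := by exact_mod_cast h2.le
    have h4 : (#P.parts : ℝ) ≤ M := by exact_mod_cast hPM
    nlinarith
  have hlo : ∀ A ∈ P.parts, (q : ℝ) ≤ #A := fun A hA => by
    exact_mod_cast hP.average_le_card_part hA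
  have hup : ∀ A ∈ P.parts, (#A : ℝ) ≤ q + 1 := fun A hA => by
    exact_mod_cast hP.card_part_le_average_add_one hA
  have hpart : ∀ a, P.part a ∈ P.parts := fun a => P.part_mem.2 (mem_univ a)
  let g : α → Finset α × ι := fun a => (P.part a, f a)
  let X : α → Finset α := fun a => {b ∈ P.part a | f b = f a}
  have hX : ∀ a x, x ∈ X a ↔ g x = g a := fun a x => by
    simp only [g, X, mem_filter, Prod.mk.injEq, P.part_eq_iff_mem (hpart a)]
  let small : Finset α := {a | (#(X a) : ℝ) < η * #(P.part a)}
  let sparse : Finset (α × α) := {p | K.Adj p.1 p.2 ∧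
    (#(Rel.interedges K.Adj (X p.1) (X p.2)) : ℝ) < e / 4 * (#(X p.1) * #(X p.2))}
  let nonuni := (P.nonUniforms K ε₀).biUnion fun (U, V) ↦ U ×ˢ V
  let diag := P.parts.biUnion offDiag
  have hsmall : (#small : ℝ) ≤ h * η * (h * n) := by
    rw [← Nat.cast_mul h n, ← hN]
    exact P.card_small_fibers_le f hη0.le
  have hsparse : (#sparse : ℝ) ≤ e / 4 * (h * n) ^ 2 := by
    rw [← Nat.cast_mul, ← hN]
    exact card_edges_sparse_fibers_le hX K.Adj (by positivity)
  have hnonuni : (#nonuni : ℝ) ≤ 4 * ε₀ * (h * n) ^ 2 := by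
    rw [← Nat.cast_mul, ← hN, ← card_univ]
    exact (hP.sum_nonUniforms_lt hA0 hε₀0 hPK).le
  have hdiag : (#diag : ℝ) ≤ e / 4 * (h * n) ^ 2 := by
    rw [← Nat.cast_mul, ← hN, ← card_univ]
    have := hP.card_biUnion_offDiag_le (ε := e / 2) (by positivity) (by
      have h5 : 8 / e ≤ #P.parts := (Nat.le_ceil _).trans (by exact_mod_cast hlP)
      have h6 : 4 / (e / 2) = 8 / e := by field_simp; norm_num
      linarith)
    rw [div_div] at this
    norm_num at this ⊢
    exact this
  obtain ⟨B, hBcard, hB⟩ := exists_union_rectangles nonuni diag sparse small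
  refine ⟨ε₀ * (q + 1), B, X,
    ?_, ?_, ?_, fun a b hb => (mem_filter.1 hb).2, fun a b hab hab' => ?_⟩
  · rw [div_mul_eq_mul_div, div_le_iff₀ (by positivity), mul_assoc]
    have : (n : ℝ) ≤ h * n := le_mul_of_one_le_left hn0.le h1
    gcongr
    linarith
  · have h2 : h * (ε₀ * (q + 1)) ≤ 2 * (h * ε₀) * (h * n) := by
      have : 0 < h * ε₀ := by positivity
      nlinarith
    have h3 : 2 * (h * ε₀) * (h * n) ≤ d ^ h * (h * η) * n := by
      have : 0 < d ^ h * η * (h * n) := by positivity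
      nlinarith
    have h4 : d ^ h * (h * η) * n ≤ d ^ h * 1 * n := by gcongr; linarith
    linarith
  · rw [hN] at hBcard
    have hB' : (#B : ℝ) ≤ #nonuni + #diag + #sparse + 2 * (#small * (h * n)) := by
      exact_mod_cast hBcard
    have hs2 : (#small : ℝ) * (h * n) ≤ h * η * (h * n) * (h * n) :=
      mul_le_mul_of_nonneg_right hsmall (by positivity)
    rw [hhη, mul_assoc, ← sq] at hs2
    have h7 : 4 * ε₀ * (h * n) ^ 2 ≤ e / 16 * (h * n) ^ 2 := by
      gcongr
      linarith
    have h8 : e * (h * n) ^ 2 ≤ ε * n ^ 2 := by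
      rw [mul_pow, ← mul_assoc]
      gcongr
    have h9 : 0 ≤ e * (h * n) ^ 2 := by positivity
    linarith
  · obtain ⟨hnu, hdi, hsp, hsa, hsb⟩ := hB a b hab'
    have hlarge : ∀ a, a ∉ small → η * #(P.part a) ≤ #(X a) := fun a ha => by
      simpa [small] using ha
    have hsize : ∀ a, a ∉ small → h * (ε₀ * (q + 1)) ≤ d ^ h * #(X a) := fun a ha => by
      have h2 : η * q ≤ #(X a) :=
        (mul_le_mul_of_nonneg_left (hlo _ (hpart a)) hη0.le).trans (hlarge a ha)
      have h3 : d ^ h * (η * q) ≤ d ^ h * #(X a) := by gcongr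
      have : 0 < h * ε₀ := by positivity
      nlinarith
    have hfrac : ∀ a, a ∉ small → #(P.part a) * ε₀ ≤ #(X a) := fun a ha => by
      refine le_trans ?_ (hlarge a ha)
      rw [mul_comm]
      gcongr
      linarith
    have hthr : ∀ a, #(P.part a) * ε₀ ≤ ε₀ * (q + 1) := fun a => by
      rw [mul_comm]
      gcongr
      exact hup _ (hpart a)
    have hself : ∀ a, a ∈ P.part a := fun a => P.mem_part_self.2 (mem_univ a)
    have hmem : ∀ a, (X a).Nonempty := fun a => ⟨a, mem_filter.2 ⟨hself a, rfl⟩⟩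
    have hne : P.part a ≠ P.part b := fun hEq => hdi <| mem_biUnion.2
      ⟨_, hpart a, mem_offDiag.2 ⟨hself a, hEq ▸ hself b, hab.ne⟩⟩
    have huni : K.IsUniform ε₀ (P.part a) (P.part b) := by
      by_contra hcon
      exact hnu <| mem_biUnion.2 ⟨(P.part a, P.part b),
        (P.mk_mem_nonUniforms ..).2 ⟨hpart a, hpart b, hne, hcon⟩,
        mem_product.2 ⟨hself a, hself b⟩⟩
    refine ⟨hsize a hsa, hsize b hsb, huni.isLowerRegular (filter_subset _ _)
      (filter_subset _ _) (hthr a) (hthr b) (hfrac a hsa) (hfrac b hsb) (hmem a) (hmem b) ?_⟩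
    have h2 : e / 4 * (#(X a) * #(X b)) ≤ (#(Rel.interedges K.Adj (X a) (X b)) : ℝ) := by
      simpa [sparse, hab] using hsp
    refine le_trans ?_ h2
    gcongr
    linarith

open Classical in
theorem IsLowerRegular.swap {α β : Type*} {r : α → β → Prop} {m d : ℝ} {S : Finset α}
    {T : Finset β} (h : IsLowerRegular r m d S T) : IsLowerRegular (fun b a => r a b) m d T S := by
  intro T' hT S' hS hmT hmS
  have h1 := h S' hS T' hT hmS hmT
  rw [mul_comm (#S' : ℝ)] at h1
  refine h1.trans (Nat.cast_le.2 (card_le_card_of_injOn Prod.swap (fun p hp => ?_)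
    Prod.swap_injective.injOn))
  have hp := Rel.mem_interedges_iff.1 (mem_coe.1 hp)
  exact Rel.mem_interedges_iff.2 ⟨hp.2.1, hp.1, hp.2.2⟩

open Classical in
theorem IsLowerRegular.imp {α β : Type*} {r s : α → β → Prop} {m d : ℝ} {S : Finset α}
    {T : Finset β} (h : IsLowerRegular r m d S T) (hrs : ∀ a ∈ S, ∀ b ∈ T, r a b → s a b) :
    IsLowerRegular s m d S T := fun S' hS T' hT hmS hmT => by
  refine (h S' hS T' hT hmS hmT).trans (Nat.cast_le.2 (card_le_card fun p hp => ?_))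
  rw [Rel.mem_interedges_iff] at hp ⊢
  exact ⟨hp.1, hp.2.1, hrs _ (hS hp.1) _ (hT hp.2.1) hp.2.2⟩

open Classical in
theorem isLowerRegular_ne {α β γ : Type*} {m d : ℝ} (hm : 2 ≤ m) (hd : d ≤ 1 / 2) (f : α → γ)
    (g : β → γ) {S : Finset α} {T : Finset β} (hg : Set.InjOn g T) :
    IsLowerRegular (fun a b => f a ≠ g b) m d S T := fun S' hS T' hT hmS hmT => by
  have hcompl : #(Rel.interedges (fun a b => ¬ f a ≠ g b) S' T') ≤ #S' := by
    refine card_le_card_of_injOn Prod.fst (fun p hp => (Rel.mem_interedges_iff.1 hp).1) ?_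
    rintro ⟨a, b⟩ hp ⟨a', b'⟩ hp' rfl
    have hp := Rel.mem_interedges_iff.1 hp
    have hp' := Rel.mem_interedges_iff.1 hp'
    simp only [ne_eq, not_not] at hp hp'
    rw [hg (hT hp.2.1) (hT hp'.2.1) (hp.2.2.symm.trans hp'.2.2)]
  have hadd := Rel.card_interedges_add_card_interedges_compl (fun a b => f a ≠ g b) S' T'
  have hadd' : (#(Rel.interedges (fun a b => f a ≠ g b) S' T') : ℝ) +
      #(Rel.interedges (fun a b => ¬ f a ≠ g b) S' T') = #S' * #T' := by exact_mod_cast hadd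
  have hcompl' : (#(Rel.interedges (fun a b => ¬ f a ≠ g b) S' T') : ℝ) ≤ #S' := by
    exact_mod_cast hcompl
  have h0 : (0 : ℝ) ≤ #S' := Nat.cast_nonneg _
  have h1 : d * (#S' * #T') ≤ 1 / 2 * (#S' * #T' : ℝ) := by gcongr
  have h2 : #S' * 2 ≤ (#S' * #T' : ℝ) := by gcongr; exact hm.trans hmT
  have h3 : d * (#S' * #T') ≤ (#(Rel.interedges (fun a b => f a ≠ g b) S' T') : ℝ) := by linarith
  convert! h3

/-- **Removal Lemma for directed graphs** (Alon–Shapira).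
A directed graph is modelled as an irreflexive relation (arcs are ordered pairs of
distinct vertices).  A copy of `H` in `G` is an injective map on vertices sending
every arc of `H` to an arc of `G`.  If a digraph `G` on `n` vertices contains at
most `δ·n^h` copies of a fixed digraph `H` on `h` vertices, then at most `ε·n²`
arcs can be removed from `G` so that the resulting digraph is `H`-free. -/
theorem removal_lemma_digraphs
    (VH : Type) [Fintype VH] (H : VH → VH → Prop) (hH : ∀ v, ¬ H v v) :
    ∀ ε : ℝ, 0 < ε → ∃ δ : ℝ, 0 < δ ∧
      ∀ (VG : Type) [Fintype VG] (Gr : VG → VG → Prop), (∀ v, ¬ Gr v v) →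
        ((Nat.card {f : VH → VG //
              Function.Injective f ∧ ∀ u v, H u v → Gr (f u) (f v)} : ℝ)
            ≤ δ * (Fintype.card VG : ℝ) ^ (Fintype.card VH)) →
        ∃ E : Set (VG × VG),
          (∀ p ∈ E, Gr p.1 p.2) ∧
          ((E.ncard : ℝ) ≤ ε * (Fintype.card VG : ℝ) ^ 2) ∧
          ¬ ∃ f : VH → VG, Function.Injective f ∧
              ∀ u v, H u v → (Gr (f u) (f v) ∧ (f u, f v) ∉ E) := by
  classical
  intro ε hε
  obtain hVH | hVH := isEmpty_or_nonempty VH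
  · refine ⟨1 / 2, by norm_num, fun VG _ Gr _ hcard => absurd hcard ?_⟩
    have : Nat.card {f : VH → VG // Function.Injective f ∧ ∀ u v, H u v → Gr (f u) (f v)} = 1 :=
      Nat.card_eq_one_iff_unique.2 ⟨inferInstance,
        ⟨⟨isEmptyElim, fun u => isEmptyElim u, fun u => isEmptyElim u⟩⟩⟩
    rw [this]
    norm_num
  obtain ⟨d, κ, hd0, hd, hκ, hreg⟩ := exists_lowerRegular_cleaning VH hε
  refine ⟨(κ / 2) ^ Fintype.card VH / 2, by positivity, fun VG _ Gr hGr hcard => ?_⟩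
  set h := Fintype.card VH
  set n := Fintype.card VG with hn
  set copies := {f : VH → VG // Function.Injective f ∧ ∀ u v, H u v → Gr (f u) (f v)}
  rw [div_mul_eq_mul_div, ← mul_pow] at hcard
  obtain hsmall | hlarge := lt_or_ge (κ * n) 2
  · have h1 : (κ / 2 * n) ^ h ≤ 1 := pow_le_one₀ (by positivity) (by linarith)
    have h2 : (Nat.card copies : ℝ) < 1 := by linarith
    have h3 : IsEmpty copies :=
      Finite.card_eq_zero_iff.1 (by exact_mod_cast Nat.lt_one_iff.1 (by exact_mod_cast h2))
    refine ⟨∅, by simp, by simp; positivity, ?_⟩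
    rintro ⟨f, hf, hfH⟩
    exact h3.elim ⟨f, hf, fun u v huv => (hfH u v huv).1⟩
  let r : VH × VG → VH × VG → Prop := fun a b =>
    H a.1 b.1 ∧ Gr a.2 b.2 ∧ (H b.1 a.1 → Gr b.2 a.2)
  let K : SimpleGraph (VH × VG) := SimpleGraph.fromRel r
  obtain ⟨m, B, X, hκm, hmn, hB, hXfst, hX⟩ :=
    hreg (VH × VG) Prod.fst K n (Fintype.card_prod _ _) (by linarith)
  refine ⟨{p | Gr p.1 p.2 ∧ ∃ u v, H u v ∧ ((u, p.1), (v, p.2)) ∈ B}, fun p hp => hp.1,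
    le_trans (Nat.cast_le.2 ?_) hB, ?_⟩
  · refine (Set.ncard_le_ncard (t := ((B.image (Prod.map Prod.snd Prod.snd) : Finset (VG × VG)) :
      Set (VG × VG))) ?_ (Finset.finite_toSet _)).trans ?_
    · rintro ⟨x, y⟩ ⟨-, u, v, -, hxy⟩
      exact mem_coe.2 (mem_image.2 ⟨_, hxy, rfl⟩)
    · rw [Set.ncard_coe_finset]
      exact card_image_le
  rintro ⟨f, hf, hfH⟩
  have hedge : ∀ u v, H u v → K.Adj (u, f u) (v, f v) ∧ ((u, f u), (v, f v)) ∉ B := by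
    refine fun u v huv => ⟨(SimpleGraph.fromRel_adj ..).2 ⟨?_, Or.inl ⟨huv, (hfH u v huv).1,
      fun hvu => (hfH v u hvu).1⟩⟩, fun hmem => (hfH u v huv).2 ⟨(hfH u v huv).1, u, v, huv, hmem⟩⟩
    intro heq
    obtain rfl : u = v := congrArg Prod.fst heq
    exact hH u huv
  have hHX : ∀ u v, H u v → h * m ≤ d ^ h * #(X (u, f u)) ∧ h * m ≤ d ^ h * #(X (v, f v)) ∧
      IsLowerRegular K.Adj m d (X (u, f u)) (X (v, f v)) :=
    fun u v huv => hX _ _ (hedge u v huv).1 (hedge u v huv).2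
  let Y : VH → Finset (VH × VG) := fun u =>
    if ∃ v, H u v ∨ H v u then X (u, f u) else {u} ×ˢ univ
  have hYX : ∀ u v, H u v ∨ H v u → Y u = X (u, f u) := fun u v huv => if_pos ⟨v, huv⟩
  have hYfst : ∀ u, ∀ a ∈ Y u, a.1 = u := by
    intro u a ha
    by_cases hu : ∃ v, H u v ∨ H v u
    · simp only [Y, if_pos hu] at ha
      exact hXfst _ a ha
    · simp only [Y, if_neg hu, mem_product, mem_singleton] at ha
      exact ha.1
  have hYcard : ∀ u, h * m ≤ d ^ h * #(Y u) := by
    intro u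
    by_cases hu : ∃ v, H u v ∨ H v u
    · simp only [Y, if_pos hu]
      obtain ⟨v, huv | hvu⟩ := hu
      · exact (hHX u v huv).1
      · exact (hHX v u hvu).2.1
    · simpa [Y, if_neg hu] using hmn
  let R : VH → VH → VH × VG → VH × VG → Prop := fun u v a b =>
    (H u v → Gr a.2 b.2) ∧ (H v u → Gr b.2 a.2) ∧ a.2 ≠ b.2
  have hKR : ∀ u v, H u v ∨ H v u → ∀ a ∈ Y u, ∀ b ∈ Y v, K.Adj a b → R u v a b := by
    intro u v huv a ha b hb hab
    obtain rfl := hYfst u a ha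
    obtain rfl := hYfst v b hb
    have hne : ∀ x y, Gr x y → x ≠ y := by
      rintro x _ hxy rfl
      exact hGr x hxy
    obtain ⟨-, ⟨h1, h2, h3⟩ | ⟨h1, h2, h3⟩⟩ := (SimpleGraph.fromRel_adj ..).1 hab
    · exact ⟨fun _ => h2, h3, hne _ _ h2⟩
    · exact ⟨h3, fun _ => h2, (hne _ _ h2).symm⟩
  have hR : ∀ u v, IsLowerRegular (R u v) m d (Y u) (Y v) := by
    intro u v
    by_cases huv : H u v ∨ H v u
    · have hreg : IsLowerRegular K.Adj m d (Y u) (Y v) := by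
        obtain h | h := huv
        · rw [hYX u v (.inl h), hYX v u (.inr h)]
          exact (hHX u v h).2.2
        · rw [hYX u v (.inr h), hYX v u (.inl h)]
          exact (hHX v u h).2.2.swap.imp fun a _ b _ hab => hab.symm
      exact hreg.imp (hKR u v huv)
    · rw [not_or] at huv
      refine (isLowerRegular_ne (by linarith) hd Prod.snd Prod.snd ?_).imp fun a _ b _ hab =>
        ⟨fun h1 => absurd h1 huv.1, fun h1 => absurd h1 huv.2, hab⟩
      exact fun a ha b hb hab => Prod.ext ((hYfst v a ha).trans (hYfst v b hb).symm) hab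
  let e : VH ≃ Fin h := Fintype.equivFin VH
  have hcount := pow_le_card_transversals (by linarith) hd0 (by linarith) h (Y ∘ e.symm)
    (fun i j => R (e.symm i) (e.symm j)) (fun i => hYcard _) fun i j _ => hR _ _
  have hinj : #{φ : Fin h → VH × VG | (∀ i, φ i ∈ (Y ∘ e.symm) i) ∧
      ∀ i j, i < j → R (e.symm i) (e.symm j) (φ i) (φ j)} ≤ Nat.card copies := by
    rw [Nat.card_eq_fintype_card, Fintype.card_subtype]
    refine card_le_card_of_injOn (fun φ u => (φ (e u)).2) (fun φ hφ => ?_) fun φ hφ ψ hψ heq => ?_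
    · simp only [mem_coe, mem_filter, mem_univ, true_and] at hφ ⊢
      have hRφ : ∀ u v, u ≠ v → R u v (φ (e u)) (φ (e v)) := by
        intro u v huv
        obtain hlt | hlt := lt_or_gt_of_ne (e.injective.ne huv)
        · simpa using hφ.2 _ _ hlt
        · have hvu : R v u (φ (e v)) (φ (e u)) := by simpa using hφ.2 _ _ hlt
          exact ⟨hvu.2.1, hvu.1, hvu.2.2.symm⟩
      refine ⟨fun u v huv => ?_, fun u v huv => (hRφ u v ?_).1 huv⟩
      · by_contra hne
        exact (hRφ u v hne).2.2 huv
      · rintro rfl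
        exact hH u huv
    · simp only [mem_coe, mem_filter, mem_univ, true_and] at hφ hψ
      funext i
      refine Prod.ext ((hYfst _ _ (hφ.1 i)).trans (hYfst _ _ (hψ.1 i)).symm) ?_
      simpa using congrFun heq (e.symm i)
  have h1 : (κ * n) ^ h ≤ m ^ h := by gcongr
  have h2 : (κ / 2 * n) ^ h ≤ (κ * n) ^ h := by gcongr; linarith
  have h3 : 0 < (κ * n) ^ h := by positivity
  have h4 : m ^ h ≤ (Nat.card copies : ℝ) := hcount.trans (Nat.cast_le.2 (by convert! hinj))
  linarith
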